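/- Let p ≥ 1, k ≥ 1, and let α_1, ..., α_{k+1} be complex numbers with Re(α_j) > p-1 for all j = 1, ..., k+1. Then ∫ ∏_{j=1}^k det(X_j)^{α_j - p} · det(I + X_1 + ... + X_k)^{-(α_1 + ... + α_{k+1})} dμ_p(X_1) ⋯ dμ_p(X_k) = ∏_{j=1}^{k+1} Γ̃_p(α_j) / Γ̃_p(α_1 + ... + α_{k+1}), where the integral is over all tuples (X_1, ..., X_k) of positive definite p×p complex self-adjoint matrices. In other words, the complex matrix-variate type-2 Dirichlet density has the same normalizing constant D̃_k = Γ̃_p(α_1 + ... + α_{k+1}) / ∏_{j=1}^{k+1} Γ̃_p(α_j) as the type-1 density. -/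

import Mathlib

open MeasureTheory Matrix
open scoped ComplexOrder

noncomputable section

/-- Parameter space `ℝ^p × ℂ^{p(p-1)/2}` for `p × p` Hermitian matrices:
the real diagonal entries together with the strictly upper-triangular complex entries. -/
abbrev HermParam (p : ℕ) : Type :=
  (Fin p → ℝ) × ({ q : Fin p × Fin p // q.1 < q.2 } → ℂ)

/-- The linear isomorphism sending the parameters to the corresponding self-adjoint matrix. -/
def toHermMatrix (p : ℕ) (T : HermParam p) : Matrix (Fin p) (Fin p) ℂ :=
  Matrix.of fun i j =>
    if h : i < j then T.2 ⟨(i, j), h⟩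
    else if h' : j < i then (starRingEnd ℂ) (T.2 ⟨(j, i), h'⟩)
    else (T.1 i : ℂ)

noncomputable instance matrixComplexMeasureSpace (m n : ℕ) :
    MeasureSpace (Matrix (Fin m) (Fin n) ℂ) :=
  inferInstanceAs (MeasureSpace (Fin m → Fin n → ℂ))

/-- The Lebesgue measure `μ_p` on Herm(p), realized as a measure on the space of
`p × p` complex matrices: the pushforward of Lebesgue measure on the parameter space
under the linear isomorphism `toHermMatrix p`. -/
def hermLebesgue (p : ℕ) : Measure (Matrix (Fin p) (Fin p) ℂ) :=
  Measure.map (toHermMatrix p) volume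

/-- The complex matrix-variate gamma function
`Γ̃_p(α) = π^{p(p-1)/2} ∏_{j=1}^p Γ(α - j + 1) = π^{p(p-1)/2} ∏_{j=0}^{p-1} Γ(α - j)`. -/
def cGammaP (p : ℕ) (α : ℂ) : ℂ :=
  (Real.pi : ℂ) ^ (p * (p - 1) / 2) * ∏ j : Fin p, Complex.Gamma (α - j)

end

theorem integrable_exp_neg_div_norm_sq {x : ℝ} (hx : 0 < x) :
    Integrable (fun z : ℂ => Real.exp (-(‖z‖ ^ 2 / x))) := by
  by_contra h
  have := Complex.integral_exp_neg_mul_rpow (p := 2) (b := x⁻¹) (by norm_num) (by positivity)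
  have h2 : (fun z : ℂ => Real.exp (-(‖z‖ ^ 2 / x)))
      = fun z : ℂ => Real.exp (-x⁻¹ * ‖z‖ ^ (2 : ℝ)) := by
    ext z
    congr 1
    rw [Real.rpow_two]; ring
  rw [h2] at h
  rw [integral_undef h] at this
  have h3 : 0 < Real.pi * x⁻¹ ^ (-2 / 2 : ℝ) * Real.Gamma (2 / 2 + 1) := by
    have := Real.Gamma_pos_of_pos (s := 2 / 2 + 1) (by norm_num)
    have := Real.pi_pos
    positivity
  linarith

theorem integral_exp_neg_div_norm_sq {x : ℝ} (hx : 0 < x) :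
    ∫ z : ℂ, Real.exp (-(‖z‖ ^ 2 / x)) = Real.pi * x := by
  have := Complex.integral_exp_neg_mul_rpow (p := 2) (b := x⁻¹) (by norm_num) (by positivity)
  have h2 : (fun z : ℂ => Real.exp (-(‖z‖ ^ 2 / x)))
      = fun z : ℂ => Real.exp (-x⁻¹ * ‖z‖ ^ (2 : ℝ)) := by
    ext z
    congr 1
    rw [Real.rpow_two]; ring
  rw [h2, this, show (-2 / 2 : ℝ) = -1 by norm_num, Real.rpow_neg_one, inv_inv,
    show (2 / 2 + 1 : ℝ) = 1 + 1 by norm_num, Real.Gamma_add_one one_ne_zero, Real.Gamma_one]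
  ring

theorem map_mulVec_volume {p : ℕ} (B : Matrix (Fin p) (Fin p) ℂ) (hB : B.det ≠ 0) :
    Measure.map (fun u : Fin p → ℂ => B *ᵥ u) volume
      = ENNReal.ofReal ((‖B.det‖ ^ 2)⁻¹) • volume := by
  have hdet : LinearMap.det ((Matrix.toLin' B).restrictScalars ℝ) = ‖B.det‖ ^ 2 := by
    rw [LinearMap.det_restrictScalars, LinearMap.det_toLin', Algebra.norm_complex_apply,
      Complex.normSq_eq_norm_sq]
  have h := Measure.map_linearMap_addHaar_eq_smul_addHaar (volume : Measure (Fin p → ℂ))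
    (f := (Matrix.toLin' B).restrictScalars ℝ) (by rw [hdet]; positivity)
  rw [hdet, abs_of_nonneg (by positivity)] at h
  exact h

theorem measurableEmbedding_mulVec {p : ℕ} (B : Matrix (Fin p) (Fin p) ℂ) (hB : B.det ≠ 0) :
    MeasurableEmbedding (fun u : Fin p → ℂ => B *ᵥ u) := by
  apply Topology.IsClosedEmbedding.measurableEmbedding
  have h : Function.Injective (fun u : Fin p → ℂ => B *ᵥ u) :=
    Matrix.mulVec_injective_iff_isUnit.2 ((Matrix.isUnit_iff_isUnit_det B).2 hB.isUnit)
  exact LinearMap.isClosedEmbedding_of_injective (f := Matrix.toLin' B)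
    (LinearMap.ker_eq_bot.2 h)

open scoped MatrixOrder in
theorem Matrix.PosDef.exists_conjTranspose_mul_self {p : ℕ} {C : Matrix (Fin p) (Fin p) ℂ}
    (hC : C.PosDef) : ∃ B : Matrix (Fin p) (Fin p) ℂ, B.det ≠ 0 ∧ C = Bᴴ * B := by
  obtain ⟨B, hB⟩ := CStarAlgebra.nonneg_iff_eq_star_mul_self.mp hC.posSemidef.nonneg
  rw [star_eq_conjTranspose] at hB
  refine ⟨B, fun h => ?_, hB⟩
  have := hC.det_pos
  rw [hB, det_mul, h, mul_zero] at this
  exact lt_irrefl _ this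

theorem gaussian_complex {p : ℕ} {C : Matrix (Fin p) (Fin p) ℂ} (hC : C.PosDef) {x : ℝ}
    (hx : 0 < x) :
    Integrable (fun u : Fin p → ℂ => Real.exp (-((star u ⬝ᵥ (C *ᵥ u)).re / x))) ∧
    ∫ u : Fin p → ℂ, Real.exp (-((star u ⬝ᵥ (C *ᵥ u)).re / x))
      = (Real.pi * x) ^ p / C.det.re := by
  obtain ⟨B, hB, rfl⟩ := hC.exists_conjTranspose_mul_self
  have key : (fun u : Fin p → ℂ => Real.exp (-((star u ⬝ᵥ ((Bᴴ * B) *ᵥ u)).re / x)))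
      = (fun y : Fin p → ℂ => ∏ i, Real.exp (-(‖y i‖ ^ 2 / x))) ∘ (fun u => B *ᵥ u) := by
    ext u
    simp only [Function.comp]
    rw [← Real.exp_sum, Finset.sum_neg_distrib, ← Finset.sum_div, ← mulVec_mulVec,
      dotProduct_mulVec, ← star_mulVec]
    congr 3
    simp [dotProduct, Complex.re_sum, ← Complex.normSq_eq_norm_sq, Complex.normSq_apply]
  have hint : Integrable (fun y : Fin p → ℂ => ∏ i, Real.exp (-(‖y i‖ ^ 2 / x))) :=
    Integrable.fintype_prod (fun _ => integrable_exp_neg_div_norm_sq hx)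
  have hme := measurableEmbedding_mulVec B hB
  have hmap := map_mulVec_volume B hB
  have hdet : (Bᴴ * B).det.re = ‖B.det‖ ^ 2 := by
    rw [det_mul, det_conjTranspose, ← Complex.normSq_eq_norm_sq]
    simp [Complex.normSq_apply]
  rw [key]
  constructor
  · rw [← hme.integrable_map_iff, hmap]
    exact hint.smul_measure (by simp)
  · simp only [Function.comp_def]
    rw [← hme.integral_map (g := fun y : Fin p → ℂ => ∏ i, Real.exp (-(‖y i‖ ^ 2 / x))),
      hmap, integral_smul_measure,
      integral_fintype_prod_volume_eq_prod (fun _ (y : ℂ) => Real.exp (-(‖y‖ ^ 2 / x)))]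
    simp only [integral_exp_neg_div_norm_sq hx, hdet]
    rw [ENNReal.toReal_ofReal (by positivity)]
    simp
    ring

theorem gaussian_complex_linear {p : ℕ} {C : Matrix (Fin p) (Fin p) ℂ} (hC : C.PosDef)
    (b : Fin p → ℂ) {x : ℝ} (hx : 0 < x) :
    Integrable (fun u : Fin p → ℂ =>
      Real.exp (-((star u ⬝ᵥ (C *ᵥ u)).re / x + 2 * (star b ⬝ᵥ u).re))) ∧
    ∫ u : Fin p → ℂ, Real.exp (-((star u ⬝ᵥ (C *ᵥ u)).re / x + 2 * (star b ⬝ᵥ u).re))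
      = (Real.pi * x) ^ p / C.det.re * Real.exp (x * (star b ⬝ᵥ (C⁻¹ *ᵥ b)).re) := by
  have hu : IsUnit C.det := hC.det_pos.ne'.isUnit
  obtain ⟨h1, h2⟩ := gaussian_complex hC hx
  set d : Fin p → ℂ := C⁻¹ *ᵥ b with hd
  have hCd : C *ᵥ d = b := by
    rw [hd, mulVec_mulVec, mul_nonsing_inv _ hu, one_mulVec]
  clear_value d
  have key : (fun u : Fin p → ℂ =>
      Real.exp (-((star u ⬝ᵥ (C *ᵥ u)).re / x + 2 * (star b ⬝ᵥ u).re)))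
      = fun u : Fin p → ℂ =>
        Real.exp (-((star (u + x • d) ⬝ᵥ (C *ᵥ (u + x • d))).re / x))
          * Real.exp (x * (star b ⬝ᵥ d).re) := by
    ext u
    rw [← Real.exp_add]
    congr 1
    have e1 : star d ⬝ᵥ (C *ᵥ u) = star b ⬝ᵥ u := by
      rw [← hCd, star_mulVec, hC.isHermitian.eq, dotProduct_mulVec]
    have e2 : (star u ⬝ᵥ b).re = (star b ⬝ᵥ u).re := by
      rw [← Complex.conj_re, ← Complex.star_def, star_dotProduct, star_star, dotProduct_comm]
    have e3 : (star d ⬝ᵥ b).re = (star b ⬝ᵥ d).re := by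
      rw [← Complex.conj_re, ← Complex.star_def, star_dotProduct, star_star, dotProduct_comm]
    simp only [mulVec_add, star_add, star_smul, mulVec_smul, hCd, add_dotProduct, dotProduct_add,
      smul_dotProduct, dotProduct_smul, e1, Complex.add_re, Complex.smul_re, e2, e3]
    simp
    field_simp
    ring
  rw [key]
  exact ⟨(h1.comp_add_right (x • d)).mul_const _, by
    rw [integral_mul_const, integral_add_right_eq_self
      (fun u : Fin p → ℂ => Real.exp (-((star u ⬝ᵥ (C *ᵥ u)).re / x))), h2]⟩

/-- The square matrix with top-left entry `x`, remaining first row `u`, remaining first column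
the conjugate of `u`, and lower-right block `Z`. -/
def bordered {p : ℕ} (x : ℝ) (u : Fin p → ℂ) (Z : Matrix (Fin p) (Fin p) ℂ) :
    Matrix (Fin (p + 1)) (Fin (p + 1)) ℂ :=
  Matrix.of (Fin.cons (Fin.cons (x : ℂ) u) fun i => Fin.cons (star (u i)) (Z i))

section bordered

variable {p : ℕ} (x : ℝ) (u : Fin p → ℂ) (Z : Matrix (Fin p) (Fin p) ℂ)

@[simp] theorem bordered_zero_zero : bordered x u Z 0 0 = x := rfl

@[simp] theorem bordered_zero_succ (j : Fin p) : bordered x u Z 0 j.succ = u j := rfl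

@[simp] theorem bordered_succ_zero (i : Fin p) : bordered x u Z i.succ 0 = star (u i) := rfl

@[simp] theorem bordered_succ_succ (i j : Fin p) : bordered x u Z i.succ j.succ = Z i j := rfl

theorem bordered_eq_submatrix_fromBlocks :
    ∃ e : Fin (p + 1) ≃ Unit ⊕ Fin p, bordered x u Z =
      (fromBlocks (of fun _ _ => (x : ℂ)) (replicateRow Unit u) (replicateRow Unit u)ᴴ Z).submatrix
        e e := by
  refine ⟨(finSuccEquiv p).trans ((Equiv.optionEquivSumPUnit (Fin p)).trans
    (Equiv.sumComm _ _)), ?_⟩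
  ext i j
  refine Fin.cases ?_ (fun i => ?_) i <;> refine Fin.cases ?_ (fun j => ?_) j <;> simp

theorem Matrix.IsHermitian.eq_bordered {A : Matrix (Fin (p + 1)) (Fin (p + 1)) ℂ}
    (hA : A.IsHermitian) :
    A = bordered (A 0 0).re (fun j => A 0 j.succ) (A.submatrix Fin.succ Fin.succ) := by
  ext i j
  refine Fin.cases ?_ (fun i => ?_) i <;> refine Fin.cases ?_ (fun j => ?_) j
  · simpa using (hA.coe_re_apply_self 0).symm
  · simp
  · simpa using (hA.apply _ _).symm
  · simp

theorem trace_bordered_mul_bordered (a : ℝ) (b : Fin p → ℂ) (C : Matrix (Fin p) (Fin p) ℂ) :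
    (bordered a b C * bordered x u Z).trace
      = a * x + b ⬝ᵥ star u + star b ⬝ᵥ u + (C * Z).trace := by
  simp only [trace, diag, mul_apply, Fin.sum_univ_succ, bordered_zero_zero, bordered_zero_succ,
    bordered_succ_zero, bordered_succ_succ, dotProduct, Pi.star_apply, Finset.sum_add_distrib]
  ring

theorem det_bordered_of_ne_zero (hx : x ≠ 0) :
    (bordered x u Z).det = x * (Z - (x : ℂ)⁻¹ • vecMulVec (star u) u).det := by
  obtain ⟨e, he⟩ := bordered_eq_submatrix_fromBlocks x u Z
  have hdet : (of fun _ _ => (x : ℂ) : Matrix Unit Unit ℂ).det = x := by simp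
  let : Invertible (of fun _ _ => (x : ℂ) : Matrix Unit Unit ℂ) :=
    invertibleOfIsUnitDet _ (by rw [hdet]; exact (Complex.ofReal_ne_zero.2 hx).isUnit)
  rw [he, det_submatrix_equiv_self, det_fromBlocks₁₁, hdet, invOf_eq_nonsing_inv]
  congr 3
  ext i j
  simp [mul_apply, vecMulVec, Ring.inverse_eq_inv']
  ring

theorem det_bordered_of_isUnit (hZ : IsUnit Z.det) :
    (bordered x u Z).det = Z.det * (x - star u ⬝ᵥ (Zᵀ⁻¹ *ᵥ u)) := by
  obtain ⟨e, he⟩ := bordered_eq_submatrix_fromBlocks x u Z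
  let : Invertible Z := invertibleOfIsUnitDet _ hZ
  rw [he, det_submatrix_equiv_self, det_fromBlocks₂₂, invOf_eq_nonsing_inv]
  congr 1
  rw [← transpose_nonsing_inv, mulVec_transpose, det_unique, dotProduct_comm]
  rw [Matrix.sub_apply]
  rfl

theorem posDef_bordered_iff (W : Matrix (Fin p) (Fin p) ℂ) :
    (bordered x u (W + (x : ℂ)⁻¹ • vecMulVec (star u) u)).PosDef ↔ 0 < x ∧ W.PosDef := by
  have hsemi (hx : 0 < x) : (bordered x u (W + (x : ℂ)⁻¹ • vecMulVec (star u) u)).PosSemidef ↔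
      W.PosSemidef := by
    obtain ⟨e, he⟩ := bordered_eq_submatrix_fromBlocks x u (W + (x : ℂ)⁻¹ • vecMulVec (star u) u)
    have hdet : (of fun _ _ => (x : ℂ) : Matrix Unit Unit ℂ).det = x := by simp
    let : Invertible (of fun _ _ => (x : ℂ) : Matrix Unit Unit ℂ) :=
      invertibleOfIsUnitDet _ (by rw [hdet]; exact (Complex.ofReal_ne_zero.2 hx.ne').isUnit)
    have hpos : (of fun _ _ => (x : ℂ) : Matrix Unit Unit ℂ).PosDef := by
      have : (of fun _ _ => (x : ℂ) : Matrix Unit Unit ℂ) = diagonal fun _ => (x : ℂ) := by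
        ext i j; simp
      rw [this, posDef_diagonal_iff]
      intro _; exact_mod_cast hx
    rw [he, posSemidef_submatrix_equiv, PosDef.fromBlocks₁₁ _ _ hpos]
    congr! 1
    ext i j
    simp [mul_apply, vecMulVec, Ring.inverse_eq_inv']
    ring
  have hdet (hx : 0 < x) : (bordered x u (W + (x : ℂ)⁻¹ • vecMulVec (star u) u)).det ≠ 0 ↔
      W.det ≠ 0 := by
    rw [det_bordered_of_ne_zero x u _ hx.ne', add_sub_cancel_right]
    simp [hx.ne']
  constructor
  · intro h
    have hx : 0 < x := by simpa using h.diag_pos (i := 0)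
    have hW := (hsemi hx).1 h.posSemidef
    exact ⟨hx, hW.posDef_iff_det_ne_zero.2 ((hdet hx).1 (h.posSemidef.posDef_iff_det_ne_zero.1 h))⟩
  · rintro ⟨hx, hW⟩
    exact ((hsemi hx).2 hW.posSemidef).posDef_iff_det_ne_zero.2
      ((hdet hx).2 (hW.posSemidef.posDef_iff_det_ne_zero.1 hW))

end bordered

theorem measurable_matrix_iff {X : Type*} [MeasurableSpace X] {m n : ℕ}
    {f : X → Matrix (Fin m) (Fin n) ℂ} : Measurable f ↔ ∀ i j, Measurable fun x => f x i j :=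
  ⟨fun h i j => measurable_pi_iff.1 (measurable_pi_iff.1 h i) j,
    fun h => measurable_pi_iff.2 fun i => measurable_pi_iff.2 fun j => h i j⟩

theorem measurable_matrix_entry {m n : ℕ} (i : Fin m) (j : Fin n) :
    Measurable fun A : Matrix (Fin m) (Fin n) ℂ => A i j :=
  measurable_matrix_iff.1 measurable_id i j

instance borelSpaceMatrix (m n : ℕ) : BorelSpace (Matrix (Fin m) (Fin n) ℂ) :=
  inferInstanceAs (BorelSpace (Fin m → Fin n → ℂ))

theorem measurableSet_posDef (p : ℕ) :
    MeasurableSet {A : Matrix (Fin p) (Fin p) ℂ | A.PosDef} := by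
  have h : {A : Matrix (Fin p) (Fin p) ℂ | A.PosDef}
      = ({A | A.IsHermitian} ∩ ⋂ v : Fin p → ℂ, {A | 0 ≤ star v ⬝ᵥ (A *ᵥ v)}) ∩
        {A | A.det ≠ 0} := by
    ext A
    simp only [Set.mem_inter_iff, Set.mem_ofPred_eq, Set.mem_iInter,
      ← posSemidef_iff_dotProduct_mulVec]
    exact ⟨fun h => ⟨h.posSemidef, h.posSemidef.posDef_iff_det_ne_zero.1 h⟩,
      fun h => h.1.posDef_iff_det_ne_zero.2 h.2⟩
  rw [h]
  refine (IsClosed.measurableSet ?_).inter (IsOpen.measurableSet ?_)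
  · refine IsClosed.inter (isClosed_eq (by fun_prop) continuous_id) (isClosed_iInter fun v => ?_)
    exact isClosed_le continuous_const (by fun_prop)
  · exact isOpen_ne_fun (by fun_prop) continuous_const

theorem measurable_toHermMatrix (p : ℕ) : Measurable (toHermMatrix p) := by
  refine measurable_matrix_iff.2 fun i j => ?_
  simp only [toHermMatrix, of_apply]
  split_ifs with h h'
  · fun_prop
  · exact Complex.continuous_conj.measurable.comp (by fun_prop)
  · fun_prop

/-- The parameters of a Hermitian matrix, read off from its entries. -/
def hermParam (p : ℕ) (A : Matrix (Fin p) (Fin p) ℂ) : HermParam p :=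
  (fun i => (A i i).re, fun q => A q.1.1 q.1.2)

theorem hermParam_toHermMatrix (p : ℕ) (T : HermParam p) : hermParam p (toHermMatrix p T) = T := by
  ext q
  · simp [hermParam, toHermMatrix]
  · simp [hermParam, toHermMatrix, q.2]

theorem toHermMatrix_hermParam {p : ℕ} {A : Matrix (Fin p) (Fin p) ℂ} (hA : A.IsHermitian) :
    toHermMatrix p (hermParam p A) = A := by
  ext i j
  simp only [hermParam, toHermMatrix, of_apply]
  split_ifs with h h'
  · rfl
  · exact hA.apply i j
  · obtain rfl : i = j := le_antisymm (not_lt.1 h') (not_lt.1 h)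
    exact hA.coe_re_apply_self i

theorem toHermMatrix_add (p : ℕ) (S T : HermParam p) :
    toHermMatrix p (S + T) = toHermMatrix p S + toHermMatrix p T := by
  ext i j
  simp only [toHermMatrix, of_apply, Matrix.add_apply]
  split_ifs <;> simp

instance sigmaFinite_hermLebesgue (p : ℕ) : SigmaFinite (hermLebesgue p) := by
  have hm : Measurable (hermParam p) :=
    (measurable_pi_iff.2 fun i => Complex.measurable_re.comp (measurable_matrix_entry i i)).prodMk
      (measurable_pi_iff.2 fun q => measurable_matrix_entry q.1.1 q.1.2)
  refine SigmaFinite.of_map _ hm.aemeasurable ?_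
  rw [hermLebesgue, Measure.map_map hm (measurable_toHermMatrix p)]
  have : hermParam p ∘ toHermMatrix p = id := funext (hermParam_toHermMatrix p)
  rw [this, Measure.map_id]
  infer_instance

theorem map_add_right_hermLebesgue {p : ℕ} {H : Matrix (Fin p) (Fin p) ℂ} (hH : H.IsHermitian) :
    Measure.map (fun W => W + H) (hermLebesgue p) = hermLebesgue p := by
  have hm : Measurable fun W : Matrix (Fin p) (Fin p) ℂ => W + H :=
    measurable_matrix_iff.2 fun i j => (measurable_matrix_entry i j).add_const _
  rw [hermLebesgue, Measure.map_map hm (measurable_toHermMatrix p)]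
  have : (fun W => W + H) ∘ toHermMatrix p = toHermMatrix p ∘ fun T => T + hermParam p H := by
    ext1 T
    simp only [Function.comp, toHermMatrix_add, toHermMatrix_hermParam hH]
  have hadd : Measurable fun T : HermParam p => T + hermParam p H := by fun_prop
  rw [this, ← Measure.map_map (measurable_toHermMatrix p) hadd]
  congr 1
  have : (volume : Measure (HermParam p)).IsAddHaarMeasure :=
    Measure.prod.instIsAddHaarMeasure volume volume
  exact map_add_right_eq_self volume (hermParam p H)

/-- Splits the parameters of a Hermitian matrix into its first row and the rest. -/
def hermParamSplit (p : ℕ) (T : HermParam (p + 1)) : (ℝ × (Fin p → ℂ)) × HermParam p :=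
  ((T.1 0, fun j => T.2 ⟨(0, j.succ), j.succ_pos⟩),
    (fun i => T.1 i.succ,
      fun q => T.2 ⟨(q.1.1.succ, q.1.2.succ), Fin.succ_lt_succ_iff.2 q.2⟩))

theorem toHermMatrix_succ (p : ℕ) (T : HermParam (p + 1)) :
    toHermMatrix (p + 1) T = bordered (hermParamSplit p T).1.1 (hermParamSplit p T).1.2
      (toHermMatrix p (hermParamSplit p T).2) := by
  ext i j
  refine Fin.cases ?_ (fun i => ?_) i <;> refine Fin.cases ?_ (fun j => ?_) j <;>
    simp [toHermMatrix, hermParamSplit]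

/-- The strictly upper-triangular positions of size `p + 1` are those of the first row together
with those of size `p`. -/
noncomputable def upperSumEquiv (p : ℕ) : Fin p ⊕ { q : Fin p × Fin p // q.1 < q.2 } ≃
    { q : Fin (p + 1) × Fin (p + 1) // q.1 < q.2 } :=
  Equiv.ofBijective
    (Sum.elim (fun j => ⟨(0, j.succ), j.succ_pos⟩)
      fun q => ⟨(q.1.1.succ, q.1.2.succ), Fin.succ_lt_succ_iff.2 q.2⟩) <| by
    constructor
    · rintro (j | ⟨⟨i, j⟩, h⟩) (j' | ⟨⟨i', j'⟩, h'⟩) hq <;>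
        simp_all [Prod.ext_iff, Fin.ext_iff]
    · rintro ⟨⟨i, j⟩, h⟩
      induction j using Fin.cases with
      | zero => exact absurd h (Fin.not_lt_zero i)
      | succ j =>
        induction i using Fin.cases with
        | zero => exact ⟨Sum.inl j, rfl⟩
        | succ i => exact ⟨Sum.inr ⟨(i, j), Fin.succ_lt_succ_iff.1 h⟩, rfl⟩

theorem volume_preserving_prod_prod_comm (α β γ δ : Type*) [MeasureSpace α] [MeasureSpace β]
    [MeasureSpace γ] [MeasureSpace δ] [SFinite (volume : Measure α)] [SFinite (volume : Measure β)]
    [SFinite (volume : Measure γ)] [SFinite (volume : Measure δ)] :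
    MeasurePreserving (fun z : (α × β) × (γ × δ) => ((z.1.1, z.2.1), (z.1.2, z.2.2))) := by
  have ida := MeasurePreserving.id (volume : Measure α)
  have hswap : MeasurePreserving (Prod.swap : β × γ → γ × β) := Measure.measurePreserving_swap
  have hmid : MeasurePreserving (fun w : β × (γ × δ) => (w.2.1, (w.1, w.2.2))) :=
    (volume_preserving_prodAssoc.comp (hswap.prod (MeasurePreserving.id (volume : Measure δ)))).comp
      volume_preserving_prodAssoc.symm
  exact (volume_preserving_prodAssoc.symm.comp (ida.prod hmid)).comp volume_preserving_prodAssoc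

theorem measurePreserving_hermParamSplit (p : ℕ) :
    MeasurePreserving (hermParamSplit p) volume volume := by
  have h1 := volume_preserving_piFinSuccAbove (fun _ : Fin (p + 1) => ℝ) 0
  have h2 := (volume_measurePreserving_sumPiEquivProdPi
      (fun _ : Fin p ⊕ { q : Fin p × Fin p // q.1 < q.2 } => ℂ)).comp
    (volume_measurePreserving_piCongrLeft (fun _ => ℂ) (upperSumEquiv p)).symm
  have h3 := h1.prod h2
  exact (volume_preserving_prod_prod_comm _ _ _ _).comp h3

theorem measurePreserving_bordered (p : ℕ) :
    MeasurePreserving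
      (fun z : (ℝ × (Fin p → ℂ)) × Matrix (Fin p) (Fin p) ℂ => bordered z.1.1 z.1.2 z.2)
      (volume.prod (hermLebesgue p)) (hermLebesgue (p + 1)) := by
  have hm : Measurable
      (fun z : (ℝ × (Fin p → ℂ)) × Matrix (Fin p) (Fin p) ℂ => bordered z.1.1 z.1.2 z.2) := by
    refine measurable_matrix_iff.2 fun i j => ?_
    refine Fin.cases ?_ (fun i => ?_) i <;> refine Fin.cases ?_ (fun j => ?_) j
    · simp only [bordered_zero_zero]; fun_prop
    · simp only [bordered_zero_succ]; fun_prop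
    · simp only [bordered_succ_zero]
      exact Complex.continuous_conj.measurable.comp (by fun_prop)
    · simp only [bordered_succ_succ]
      exact (measurable_matrix_entry i j).comp measurable_snd
  refine ⟨hm, ?_⟩
  have hT : MeasurePreserving (toHermMatrix p) volume (hermLebesgue p) :=
    ⟨measurable_toHermMatrix p, rfl⟩
  have h := ((MeasurePreserving.id (volume : Measure (ℝ × (Fin p → ℂ)))).prod hT).comp
    (measurePreserving_hermParamSplit p)
  rw [← h.map_eq, Measure.map_map hm h.measurable, hermLebesgue]
  congr 1
  exact funext fun T => (toHermMatrix_succ p T).symm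

/-- The Hermitian matrix with first row `(x, u)` and Schur complement `W` of its top-left entry. -/
noncomputable def schurBordered {p : ℕ} (z : (ℝ × (Fin p → ℂ)) × Matrix (Fin p) (Fin p) ℂ) :
    Matrix (Fin (p + 1)) (Fin (p + 1)) ℂ :=
  bordered z.1.1 z.1.2 (z.2 + (z.1.1 : ℂ)⁻¹ • vecMulVec (star z.1.2) z.1.2)

theorem measurePreserving_schurBordered (p : ℕ) :
    MeasurePreserving (schurBordered (p := p)) (volume.prod (hermLebesgue p))
      (hermLebesgue (p + 1)) := by
  have h : MeasurePreserving
      (fun z : (ℝ × (Fin p → ℂ)) × Matrix (Fin p) (Fin p) ℂ =>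
        (z.1, z.2 + (z.1.1 : ℂ)⁻¹ • vecMulVec (star z.1.2) z.1.2))
      (volume.prod (hermLebesgue p)) (volume.prod (hermLebesgue p)) := by
    refine (MeasurePreserving.id (volume : Measure (ℝ × (Fin p → ℂ)))).skew_product
      (g := fun y W => W + (y.1 : ℂ)⁻¹ • vecMulVec (star y.2) y.2) ?_
      (Filter.Eventually.of_forall fun y => ?_)
    · refine measurable_matrix_iff.2 fun i j => ?_
      refine ((measurable_matrix_entry i j).comp measurable_snd).add ?_
      have hs : Measurable fun z : ℂ => star z := Complex.continuous_conj.measurable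
      simp only [Matrix.smul_apply, vecMulVec_apply, Pi.star_apply]
      refine Measurable.mul (by fun_prop) (Measurable.mul (hs.comp ?_) ?_) <;> fun_prop
    · refine map_add_right_hermLebesgue ?_
      ext i j
      simp [vecMulVec_apply, mul_comm]
  exact (measurePreserving_bordered p).comp h

theorem map_schurBordered_restrict (p : ℕ) :
    Measure.map (schurBordered (p := p))
      ((((volume.restrict (Set.Ioi 0) : Measure ℝ).prod volume).prod
        ((hermLebesgue p).restrict {A | A.PosDef})))
      = (hermLebesgue (p + 1)).restrict {A | A.PosDef} := by
  have h := (measurePreserving_schurBordered p).restrict_preimage (measurableSet_posDef (p + 1))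
  rw [← h.map_eq]
  congr 1
  have hpre : schurBordered (p := p) ⁻¹' {A | A.PosDef}
      = (Set.Ioi 0 ×ˢ Set.univ) ×ˢ {A | A.PosDef} := by
    ext z
    simp only [Set.mem_preimage, Set.mem_ofPred_eq, schurBordered, posDef_bordered_iff]
    simp
  rw [hpre, ← Measure.prod_restrict, Measure.volume_eq_prod, ← Measure.prod_restrict,
    Measure.restrict_univ]

theorem Matrix.PosDef.det_re_pos {p : ℕ} {A : Matrix (Fin p) (Fin p) ℂ} (hA : A.PosDef) :
    0 < A.det.re := (Complex.lt_def.1 hA.det_pos).1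

theorem Matrix.PosDef.ofReal_det_re {p : ℕ} {A : Matrix (Fin p) (Fin p) ℂ} (hA : A.PosDef) :
    (A.det.re : ℂ) = A.det :=
  Complex.ext rfl (Complex.lt_def.1 hA.det_pos).2

theorem integral_rowKernel {p : ℕ} {C : Matrix (Fin p) (Fin p) ℂ} (hC : C.PosDef) (a : ℝ)
    (b : Fin p → ℂ) (hd : 0 < a - (star b ⬝ᵥ (C⁻¹ *ᵥ b)).re) {α : ℂ} (hα : (p : ℝ) < α.re) :
    Integrable (fun y : ℝ × (Fin p → ℂ) => (y.1 : ℂ) ^ (α - (p + 1)) *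
        ((Real.exp (-(a * y.1)) * Real.exp (-((star y.2 ⬝ᵥ (C *ᵥ y.2)).re / y.1 +
          2 * (star b ⬝ᵥ y.2).re)) : ℝ) : ℂ)) ((volume.restrict (Set.Ioi 0)).prod volume) ∧
    ∫ y : ℝ × (Fin p → ℂ), (y.1 : ℂ) ^ (α - (p + 1)) *
        ((Real.exp (-(a * y.1)) * Real.exp (-((star y.2 ⬝ᵥ (C *ᵥ y.2)).re / y.1 +
          2 * (star b ⬝ᵥ y.2).re)) : ℝ) : ℂ) ∂((volume.restrict (Set.Ioi 0)).prod volume)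
      = (Real.pi : ℂ) ^ p / C.det.re *
        (((a - (star b ⬝ᵥ (C⁻¹ *ᵥ b)).re : ℝ) : ℂ) ^ (-α) * Complex.Gamma α) := by
  set d : ℝ := a - (star b ⬝ᵥ (C⁻¹ *ᵥ b)).re with hd_def
  have hC0 := hC.det_re_pos
  have hα0 : 0 < α.re := (Nat.cast_nonneg p).trans_lt hα
  have hexp (x : ℝ) : Real.exp (-(a * x)) * Real.exp (x * (star b ⬝ᵥ (C⁻¹ *ᵥ b)).re)
      = Real.exp (-d * x) := by
    rw [← Real.exp_add, hd_def]; congr 1; ring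
  set f : ℝ × (Fin p → ℂ) → ℂ := fun y => (y.1 : ℂ) ^ (α - (p + 1)) *
        ((Real.exp (-(a * y.1)) * Real.exp (-((star y.2 ⬝ᵥ (C *ᵥ y.2)).re / y.1 +
          2 * (star b ⬝ᵥ y.2).re)) : ℝ) : ℂ) with hf
  have hmeas : AEStronglyMeasurable f ((volume.restrict (Set.Ioi 0)).prod volume) := by
    have hs : Continuous fun u : Fin p → ℂ => (star u ⬝ᵥ (C *ᵥ u)).re := by fun_prop
    have hl : Continuous fun u : Fin p → ℂ => (star b ⬝ᵥ u).re := by fun_prop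
    have hs' : Measurable fun y : ℝ × (Fin p → ℂ) => (star y.2 ⬝ᵥ (C *ᵥ y.2)).re :=
      hs.measurable.comp measurable_snd
    have hl' : Measurable fun y : ℝ × (Fin p → ℂ) => (star b ⬝ᵥ y.2).re :=
      hl.measurable.comp measurable_snd
    apply Measurable.aestronglyMeasurable
    fun_prop
  have hinner {x : ℝ} (hx : 0 < x) : Integrable (fun u => f (x, u)) := by
    exact (((gaussian_complex_linear hC b hx).1.const_mul (Real.exp (-(a * x)))).ofReal
      (𝕜 := ℂ)).const_mul ((x : ℂ) ^ (α - (p + 1)))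
  have hnorm {x : ℝ} (hx : 0 < x) : ∫ u, ‖f (x, u)‖
      = Real.pi ^ p / C.det.re * (x ^ (α.re - 1) * Real.exp (-d * x ^ (1 : ℝ))) := by
    have h1 (u : Fin p → ℂ) : ‖f (x, u)‖ = x ^ (α.re - (p + 1)) *
        (Real.exp (-(a * x)) * Real.exp (-((star u ⬝ᵥ (C *ᵥ u)).re / x +
          2 * (star b ⬝ᵥ u).re))) := by
      rw [hf, norm_mul, Complex.norm_cpow_eq_rpow_re_of_pos hx, Complex.norm_real,
        Real.norm_of_nonneg (by positivity)]
      simp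
    have h2 : x ^ (α.re - 1) = x ^ (α.re - (p + 1)) * x ^ p := by
      rw [← Real.rpow_natCast, ← Real.rpow_add hx]; congr 1; ring
    simp_rw [h1]
    rw [integral_const_mul, integral_const_mul, (gaussian_complex_linear hC b hx).2, Real.rpow_one,
      ← hexp, h2, mul_pow]
    ring
  have hval {x : ℝ} (hx : 0 < x) : ∫ u, f (x, u)
      = (Real.pi : ℂ) ^ p / C.det.re * ((x : ℂ) ^ (α - 1) * Complex.exp (-(d * x))) := by
    have h2 : (x : ℂ) ^ (α - 1) = (x : ℂ) ^ (α - (p + 1)) * (x : ℂ) ^ p := by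
      rw [← Complex.cpow_natCast, ← Complex.cpow_add _ _ (Complex.ofReal_ne_zero.2 hx.ne')]
      congr 1; ring
    have h3 : Complex.exp (-(d * x)) = ((Real.exp (-d * x) : ℝ) : ℂ) := by
      push_cast; congr 1; ring
    simp only [hf]
    rw [integral_const_mul, integral_complex_ofReal, integral_const_mul,
      (gaussian_complex_linear hC b hx).2, h2, h3, ← hexp]
    push_cast
    ring
  have hint : Integrable f ((volume.restrict (Set.Ioi 0)).prod volume) := by
    refine (integrable_prod_iff hmeas).2 ⟨?_, ?_⟩
    · exact ae_restrict_of_forall_mem measurableSet_Ioi fun x hx => hinner hx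
    · have h := integrableOn_rpow_mul_exp_neg_mul_rpow (p := 1) (s := α.re - 1) (b := d)
        (by linarith) one_pos hd
      exact IntegrableOn.congr_fun (h.const_mul (Real.pi ^ p / C.det.re))
        (fun x hx => (hnorm hx).symm) measurableSet_Ioi
  refine ⟨hint, ?_⟩
  rw [integral_prod _ hint, setIntegral_congr_fun measurableSet_Ioi (fun x hx => hval hx),
    integral_const_mul, Complex.integral_cpow_mul_exp_neg_mul_Ioi hα0 hd, one_div, Complex.inv_cpow,
    Complex.cpow_neg]
  rw [Complex.arg_ofReal_of_nonneg hd.le]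
  exact Real.pi_pos.ne

/-- The integrand of the matrix-variate gamma integral with parameter matrix `A`. -/
noncomputable def gammaKernel {p : ℕ} (β : ℂ) (A X : Matrix (Fin p) (Fin p) ℂ) : ℂ :=
  (X.det.re : ℂ) ^ β * ((Real.exp (-(A * X).trace.re) : ℝ) : ℂ)

theorem measurable_gammaKernel {p : ℕ} (β : ℂ) :
    Measurable fun z : Matrix (Fin p) (Fin p) ℂ × Matrix (Fin p) (Fin p) ℂ =>
      gammaKernel β z.1 z.2 := by
  have h1 : Continuous fun X : Matrix (Fin p) (Fin p) ℂ => X.det := by fun_prop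
  have h1' : Measurable fun z : Matrix (Fin p) (Fin p) ℂ × Matrix (Fin p) (Fin p) ℂ => z.2.det :=
    h1.measurable.comp measurable_snd
  have h2 : Measurable fun z : Matrix (Fin p) (Fin p) ℂ × Matrix (Fin p) (Fin p) ℂ =>
      (z.1 * z.2).trace := by
    simp only [trace, diag, mul_apply]
    refine Finset.measurable_sum _ fun i _ => Finset.measurable_sum _ fun j _ => ?_
    exact ((measurable_matrix_entry i j).comp measurable_fst).mul
      ((measurable_matrix_entry j i).comp measurable_snd)
  unfold gammaKernel
  fun_prop

theorem norm_gammaKernel {p : ℕ} (β : ℂ) (A : Matrix (Fin p) (Fin p) ℂ)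
    {X : Matrix (Fin p) (Fin p) ℂ} (hX : X.PosDef) :
    (‖gammaKernel β A X‖ : ℂ) = gammaKernel (β.re : ℂ) A X := by
  rw [gammaKernel, norm_mul, Complex.norm_cpow_eq_rpow_re_of_pos hX.det_re_pos, Complex.norm_real,
    Real.norm_of_nonneg (Real.exp_pos _).le, gammaKernel, Complex.ofReal_mul,
    Complex.ofReal_cpow hX.det_re_pos.le]

theorem cGammaP_succ (p : ℕ) (α : ℂ) :
    cGammaP (p + 1) α = (Real.pi : ℂ) ^ p * Complex.Gamma α * cGammaP p (α - 1) := by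
  have h : (p + 1) * (p + 1 - 1) / 2 = p + p * (p - 1) / 2 := by
    rw [← Finset.sum_range_id_mul_two, ← Finset.sum_range_id_mul_two, Finset.sum_range_succ]
    omega
  rw [cGammaP, cGammaP, h, pow_add, Fin.prod_univ_succ]
  have h2 (i : Fin p) : α - ((i.succ : Fin (p + 1)) : ℕ) = α - 1 - (i : ℕ) := by
    simp; ring
  simp only [h2]
  simp
  ring

theorem gammaKernel_bordered_schurBordered {p : ℕ} (α : ℂ) (a : ℝ) (b : Fin p → ℂ)
    (C : Matrix (Fin p) (Fin p) ℂ) {x : ℝ} (hx : 0 < x) (u : Fin p → ℂ)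
    {W : Matrix (Fin p) (Fin p) ℂ} (hW : W.PosDef) :
    gammaKernel (α - (p + 1 : ℕ)) (bordered a b C) (schurBordered ((x, u), W)) =
      ((x : ℂ) ^ (α - (p + 1)) *
        ((Real.exp (-(a * x)) * Real.exp (-((star u ⬝ᵥ (Cᵀ *ᵥ u)).re / x +
          2 * (star b ⬝ᵥ u).re)) : ℝ) : ℂ)) * gammaKernel (α - 1 - p) C W := by
  have hdet : (schurBordered ((x, u), W)).det.re = x * W.det.re := by
    rw [schurBordered, det_bordered_of_ne_zero _ _ _ hx.ne', add_sub_cancel_right,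
      Complex.re_ofReal_mul]
  have htr : (C * vecMulVec (star u) u).trace = star u ⬝ᵥ (Cᵀ *ᵥ u) := by
    rw [mul_vecMulVec, trace_vecMulVec, mulVec_transpose, dotProduct_comm, dotProduct_mulVec,
      dotProduct_comm]
  have hb : (b ⬝ᵥ star u).re = (star b ⬝ᵥ u).re := by
    rw [← Complex.conj_re, ← Complex.star_def, ← star_dotProduct_star, star_star, dotProduct_comm]
  have htrace : (bordered a b C * schurBordered ((x, u), W)).trace.re
      = a * x + ((star u ⬝ᵥ (Cᵀ *ᵥ u)).re / x + 2 * (star b ⬝ᵥ u).re) + (C * W).trace.re := by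
    rw [schurBordered, trace_bordered_mul_bordered, Matrix.mul_add, trace_add, Matrix.mul_smul,
      trace_smul, htr, ← Complex.ofReal_inv]
    simp only [Complex.add_re, smul_eq_mul, Complex.re_ofReal_mul, hb]
    simp
    ring
  rw [gammaKernel, gammaKernel, hdet, htrace, Complex.ofReal_mul,
    Complex.mul_cpow_ofReal_nonneg hx.le hW.det_re_pos.le, neg_add, Real.exp_add, neg_add,
    Real.exp_add]
  have h1 : α - 1 - (p : ℂ) = α - (p + 1) := by ring
  rw [h1]
  push_cast
  ring

theorem integral_gammaKernel (p : ℕ) : ∀ {α : ℂ}, (p - 1 : ℝ) < α.re →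
    ∀ {A : Matrix (Fin p) (Fin p) ℂ}, A.PosDef →
      Integrable (gammaKernel (α - p) A) ((hermLebesgue p).restrict {X | X.PosDef}) ∧
      ∫ X in {X | X.PosDef}, gammaKernel (α - p) A X ∂(hermLebesgue p)
        = cGammaP p α * (A.det.re : ℂ) ^ (-α) := by
  induction p with
  | zero =>
    intro α _ A _
    have hk (X : Matrix (Fin 0) (Fin 0) ℂ) : gammaKernel (α - (0 : ℕ)) A X = 1 := by
      simp [gammaKernel, trace]
    have hset : {X : Matrix (Fin 0) (Fin 0) ℂ | X.PosDef} = Set.univ := by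
      ext X
      simp [Subsingleton.elim X 1, PosDef.one]
    have hone : hermLebesgue 0 Set.univ = 1 := by
      rw [hermLebesgue, Measure.map_apply (measurable_toHermMatrix 0) MeasurableSet.univ,
        Set.preimage_univ, Measure.volume_eq_prod, ← Set.univ_prod_univ, Measure.prod_prod]
      simp [volume_pi]
    have : IsProbabilityMeasure (hermLebesgue 0) := ⟨hone⟩
    have hk' : gammaKernel (α - (0 : ℕ)) A = fun _ => 1 := funext hk
    rw [hset, Measure.restrict_univ, hk']
    refine ⟨integrable_const _, ?_⟩
    simp [cGammaP]
  | succ p ih =>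
    intro α hα A hA
    push_cast at hα
    obtain ⟨a, b, C, rfl, hC⟩ : ∃ (a : ℝ) (b : Fin p → ℂ) (C : Matrix (Fin p) (Fin p) ℂ),
        A = bordered a b C ∧ C.PosDef :=
      ⟨_, _, _, hA.isHermitian.eq_bordered, hA.submatrix (Fin.succ_injective p)⟩
    set s : ℝ := a - (star b ⬝ᵥ (Cᵀ⁻¹ *ᵥ b)).re with hs
    have hdetA : (bordered a b C).det.re = C.det.re * s := by
      rw [det_bordered_of_isUnit _ _ _ hC.det_pos.ne'.isUnit, ← hC.ofReal_det_re,
        Complex.re_ofReal_mul]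
      simp [hs]
    have hspos : 0 < s := by
      have := hA.det_re_pos
      rw [hdetA] at this
      exact pos_of_mul_pos_right this hC.det_re_pos.le
    obtain ⟨hF, hFv⟩ := integral_rowKernel hC.transpose a b hspos (α := α) (by linarith)
    rw [← hs] at hFv
    obtain ⟨hG, hGv⟩ := ih (α := α - 1) (by simp; linarith) hC
    have hm : AEStronglyMeasurable (gammaKernel (α - (p + 1 : ℕ)) (bordered a b C))
        ((hermLebesgue (p + 1)).restrict {X | X.PosDef}) :=
      ((measurable_gammaKernel _).comp measurable_prodMk_left).aestronglyMeasurable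
    have hΦ := (measurePreserving_schurBordered p).measurable
    rw [← map_schurBordered_restrict] at hm ⊢
    have hae : gammaKernel (α - (p + 1 : ℕ)) (bordered a b C) ∘ schurBordered (p := p)
        =ᵐ[((volume.restrict (Set.Ioi 0) : Measure ℝ).prod volume).prod
          ((hermLebesgue p).restrict {A | A.PosDef})] fun z => ((z.1.1 : ℂ) ^ (α - (p + 1)) *
        ((Real.exp (-(a * z.1.1)) * Real.exp (-((star z.1.2 ⬝ᵥ (Cᵀ *ᵥ z.1.2)).re / z.1.1 +
          2 * (star b ⬝ᵥ z.1.2).re)) : ℝ) : ℂ)) * gammaKernel (α - 1 - p) C z.2 := by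
      have hμ : ((volume.restrict (Set.Ioi 0) : Measure ℝ).prod
          (volume : Measure (Fin p → ℂ))).prod ((hermLebesgue p).restrict {A | A.PosDef})
          = ((volume.prod volume).prod (hermLebesgue p)).restrict
            ((Set.Ioi 0 ×ˢ Set.univ) ×ˢ {A | A.PosDef}) := by
        rw [← Measure.prod_restrict, ← Measure.prod_restrict, Measure.restrict_univ]
      rw [hμ]
      refine ae_restrict_of_forall_mem
        ((measurableSet_Ioi.prod MeasurableSet.univ).prod (measurableSet_posDef p)) ?_
      rintro ⟨⟨x, u⟩, W⟩ ⟨⟨hx, -⟩, hW⟩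
      exact gammaKernel_bordered_schurBordered α a b C hx u hW
    constructor
    · rw [integrable_map_measure hm hΦ.aemeasurable, integrable_congr hae]
      exact hF.mul_prod hG
    · rw [integral_map hΦ.aemeasurable hm]
      refine (integral_congr_ae hae).trans ?_
      rw [integral_prod_mul
        (fun y : ℝ × (Fin p → ℂ) => (y.1 : ℂ) ^ (α - (p + 1)) *
        ((Real.exp (-(a * y.1)) * Real.exp (-((star y.2 ⬝ᵥ (Cᵀ *ᵥ y.2)).re / y.1 +
          2 * (star b ⬝ᵥ y.2).re)) : ℝ) : ℂ)), hFv, hGv, cGammaP_succ, hdetA, det_transpose,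
        Complex.ofReal_mul, Complex.mul_cpow_ofReal_nonneg hC.det_re_pos.le hspos.le]
      have hC0 : (C.det.re : ℂ) ≠ 0 := Complex.ofReal_ne_zero.2 hC.det_re_pos.ne'
      have h1 : (C.det.re : ℂ) ^ (-(α - 1)) = (C.det.re : ℂ) ^ (-α) * C.det.re := by
        have e : -(α - 1) = -α + 1 := by ring
        rw [e, Complex.cpow_add _ _ hC0, Complex.cpow_one]
      rw [h1]
      field_simp

theorem integral_norm_gammaKernel {p : ℕ} {α : ℂ} (hα : (p - 1 : ℝ) < α.re)
    {A : Matrix (Fin p) (Fin p) ℂ} (hA : A.PosDef) :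
    ∫ X in {X | X.PosDef}, ‖gammaKernel (α - p) A X‖ ∂(hermLebesgue p)
      = ‖cGammaP p (α.re : ℂ)‖ * ‖(A.det.re : ℂ) ^ (-α)‖ := by
  have h1 : ((∫ X in {X | X.PosDef}, ‖gammaKernel (α - p) A X‖ ∂(hermLebesgue p) : ℝ) : ℂ)
      = cGammaP p (α.re : ℂ) * (A.det.re : ℂ) ^ (-(α.re : ℂ)) := by
    rw [← (integral_gammaKernel p (α := (α.re : ℂ)) (by simpa using hα) hA).2,
      ← integral_complex_ofReal]
    refine setIntegral_congr_fun (measurableSet_posDef p) fun X hX => ?_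
    simp only [norm_gammaKernel _ A hX]
    simp
  have h2 := congrArg norm h1
  rw [Complex.norm_real, Real.norm_of_nonneg (integral_nonneg fun _ => norm_nonneg _),
    norm_mul] at h2
  rw [h2, Complex.norm_cpow_eq_rpow_re_of_pos hA.det_re_pos,
    Complex.norm_cpow_eq_rpow_re_of_pos hA.det_re_pos]
  simp

theorem prod_cpow_mul_gammaKernel {p k : ℕ} (α : Fin (k + 1) → ℂ)
    (A : Matrix (Fin p) (Fin p) ℂ) {Y : Matrix (Fin p) (Fin p) ℂ} (hY : Y.PosDef) :
    (∏ j : Fin k, (Y.det.re : ℂ) ^ (-α j.castSucc)) * gammaKernel (∑ j, α j - p) A Y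
      = gammaKernel (α (Fin.last k) - p) A Y := by
  have h0 : (Y.det.re : ℂ) ≠ 0 := Complex.ofReal_ne_zero.2 hY.det_re_pos.ne'
  have h1 : ∏ j : Fin k, (Y.det.re : ℂ) ^ (-α j.castSucc)
      = (Y.det.re : ℂ) ^ (-∑ j : Fin k, α j.castSucc) := by
    simp only [Complex.cpow_def_of_ne_zero h0]
    rw [← Complex.exp_sum, ← Finset.mul_sum, Finset.sum_neg_distrib]
  rw [gammaKernel, gammaKernel, ← mul_assoc, h1, ← Complex.cpow_add _ _ h0, Fin.sum_univ_castSucc]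
  congr 2
  ring

theorem prod_gammaKernel_mul_gammaKernel_one {p k : ℕ} (β : Fin k → ℂ) (γ : ℂ)
    (X : Fin k → Matrix (Fin p) (Fin p) ℂ) (Y : Matrix (Fin p) (Fin p) ℂ) :
    (∏ j, gammaKernel (β j) Y (X j)) * gammaKernel γ 1 Y
      = (∏ j, ((X j).det.re : ℂ) ^ β j) * gammaKernel γ (1 + ∑ j, X j) Y := by
  have h : ((1 + ∑ j, X j) * Y).trace.re = (1 * Y).trace.re + ∑ j, (Y * X j).trace.re := by
    simp only [Matrix.add_mul, Matrix.sum_mul, trace_add, trace_sum, Complex.add_re, Complex.re_sum,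
      trace_mul_comm Y]
  simp only [gammaKernel]
  rw [h, neg_add, Real.exp_add, ← Finset.sum_neg_distrib, Real.exp_sum, Finset.prod_mul_distrib]
  push_cast
  ring

theorem cGammaP_ne_zero {p : ℕ} {α : ℂ} (hα : (p - 1 : ℝ) < α.re) : cGammaP p α ≠ 0 := by
  refine mul_ne_zero (pow_ne_zero _ (Complex.ofReal_ne_zero.2 Real.pi_ne_zero))
    (Finset.prod_ne_zero_iff.2 fun j _ => Complex.Gamma_ne_zero_of_re_pos ?_)
  have hj : ((j : ℕ) : ℝ) + 1 ≤ p := by exact_mod_cast j.2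
  simp
  linarith

/-- The product of gamma kernels whose iterated integrals evaluate the type-2 Dirichlet integral. -/
noncomputable def dirichletKernel {p k : ℕ} (α : Fin (k + 1) → ℂ)
    (z : (Fin k → Matrix (Fin p) (Fin p) ℂ) × Matrix (Fin p) (Fin p) ℂ) : ℂ :=
  (∏ j : Fin k, gammaKernel (α j.castSucc - p) z.2 (z.1 j)) * gammaKernel (∑ j, α j - p) 1 z.2

theorem measurable_dirichletKernel {p k : ℕ} (α : Fin (k + 1) → ℂ) :
    Measurable (dirichletKernel (p := p) α) := by
  have h1 (j : Fin k) : Measurable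
      fun z : (Fin k → Matrix (Fin p) (Fin p) ℂ) × Matrix (Fin p) (Fin p) ℂ =>
        gammaKernel (α j.castSucc - p) z.2 (z.1 j) := by
    have h : Measurable
        fun z : (Fin k → Matrix (Fin p) (Fin p) ℂ) × Matrix (Fin p) (Fin p) ℂ =>
          (z.2, z.1 j) := by fun_prop
    have h' := (measurable_gammaKernel (α j.castSucc - p)).comp h
    exact h'
  have h2 : Measurable
      fun z : (Fin k → Matrix (Fin p) (Fin p) ℂ) × Matrix (Fin p) (Fin p) ℂ =>
        gammaKernel (∑ j, α j - p) 1 z.2 := by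
    have h : Measurable
        fun z : (Fin k → Matrix (Fin p) (Fin p) ℂ) × Matrix (Fin p) (Fin p) ℂ =>
          ((1 : Matrix (Fin p) (Fin p) ℂ), z.2) := by fun_prop
    have h' := (measurable_gammaKernel (∑ j, α j - p)).comp h
    exact h'
  exact (Finset.measurable_fun_prod _ fun j _ => h1 j).mul h2

theorem integrable_dirichletKernel {p k : ℕ} {α : Fin (k + 1) → ℂ}
    (hα : ∀ j, (p - 1 : ℝ) < (α j).re) :
    Integrable (dirichletKernel (p := p) α)
      ((Measure.pi fun _ : Fin k => (hermLebesgue p).restrict {X | X.PosDef}).prod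
        ((hermLebesgue p).restrict {X | X.PosDef})) := by
  refine (integrable_prod_iff' (measurable_dirichletKernel α).aestronglyMeasurable).2 ⟨?_, ?_⟩
  · refine ae_restrict_of_forall_mem (measurableSet_posDef p) fun Y hY => ?_
    have h := Integrable.fintype_prod fun j : Fin k =>
      (integral_gammaKernel p (hα j.castSucc) hY).1
    exact h.mul_const (gammaKernel (∑ j, α j - p) 1 Y)
  · refine IntegrableOn.congr_fun (f := fun Y => ‖∏ j : Fin k, cGammaP p ((α j.castSucc).re : ℂ)‖ *
      ‖gammaKernel (α (Fin.last k) - p) 1 Y‖) ?_ ?_ (measurableSet_posDef p)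
    · exact (integral_gammaKernel p (hα (Fin.last k)) PosDef.one).1.norm.const_mul _
    · intro Y hY
      simp only [dirichletKernel, norm_mul, norm_prod]
      rw [integral_mul_const, integral_fintype_prod_eq_prod
        (fun (j : Fin k) X => ‖gammaKernel (α j.castSucc - p) Y X‖)]
      simp only [integral_norm_gammaKernel (hα _) hY]
      rw [Finset.prod_mul_distrib, mul_assoc, ← norm_prod (f := fun j : Fin k =>
        (Y.det.re : ℂ) ^ (-α j.castSucc)), ← norm_mul, prod_cpow_mul_gammaKernel α 1 hY]

theorem integral_dirichletKernel_left {p k : ℕ} {α : Fin (k + 1) → ℂ}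
    (hα : ∀ j, (p - 1 : ℝ) < (α j).re) {Y : Matrix (Fin p) (Fin p) ℂ} (hY : Y.PosDef) :
    ∫ X, dirichletKernel α (X, Y)
        ∂(Measure.pi fun _ : Fin k => (hermLebesgue p).restrict {X | X.PosDef})
      = (∏ j : Fin k, cGammaP p (α j.castSucc)) * gammaKernel (α (Fin.last k) - p) 1 Y := by
  simp only [dirichletKernel]
  rw [integral_mul_const, integral_fintype_prod_eq_prod
    (fun (j : Fin k) X => gammaKernel (α j.castSucc - p) Y X)]
  simp only [(integral_gammaKernel p (hα _) hY).2]
  rw [Finset.prod_mul_distrib, mul_assoc, prod_cpow_mul_gammaKernel α 1 hY]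

theorem integral_dirichletKernel_right {p k : ℕ} {α : Fin (k + 1) → ℂ}
    (hα : (p - 1 : ℝ) < (∑ j, α j).re) {X : Fin k → Matrix (Fin p) (Fin p) ℂ}
    (hX : ∀ j, (X j).PosDef) :
    ∫ Y in {Y | Y.PosDef}, dirichletKernel α (X, Y) ∂(hermLebesgue p)
      = (∏ j : Fin k, ((X j).det.re : ℂ) ^ (α j.castSucc - p)) *
        ((1 + ∑ j, X j).det.re : ℂ) ^ (-(∑ j, α j)) * cGammaP p (∑ j, α j) := by
  have h1 : (1 + ∑ j, X j).PosDef :=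
    PosDef.one.add_posSemidef (posSemidef_sum _ fun j _ => (hX j).posSemidef)
  simp only [dirichletKernel, prod_gammaKernel_mul_gammaKernel_one]
  rw [integral_const_mul, (integral_gammaKernel p hα h1).2]
  ring

theorem stmt12 (p k : ℕ) (hp : 1 ≤ p) (hk : 1 ≤ k) (α : Fin (k + 1) → ℂ)
    (hα : ∀ j, (p - 1 : ℝ) < (α j).re) :
    ∫ X in {X : Fin k → Matrix (Fin p) (Fin p) ℂ | ∀ j, (X j).PosDef},
      ((∏ j : Fin k, ((X j).det.re : ℂ) ^ (α j.castSucc - p)) *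
        (((1 + ∑ j, X j).det.re : ℂ) ^ (-(∑ j, α j))))
      ∂(Measure.pi fun _ : Fin k => hermLebesgue p)
    = (∏ j : Fin (k + 1), cGammaP p (α j)) / cGammaP p (∑ j, α j) := by
  have hσ : (p - 1 : ℝ) < (∑ j, α j).re := by
    have hp' : (1 : ℝ) ≤ p := by exact_mod_cast hp
    rw [Complex.re_sum, Fin.sum_univ_castSucc]
    have := Finset.sum_nonneg fun (j : Fin k) (_ : j ∈ Finset.univ) =>
      (sub_nonneg.2 hp').trans (hα j.castSucc).le
    linarith [hα (Fin.last k)]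
  have hset : {X : Fin k → Matrix (Fin p) (Fin p) ℂ | ∀ j, (X j).PosDef}
      = Set.univ.pi fun _ => {X | X.PosDef} := by
    ext; simp
  have hmeas : MeasurableSet {X : Fin k → Matrix (Fin p) (Fin p) ℂ | ∀ j, (X j).PosDef} := by
    rw [hset]
    exact MeasurableSet.univ_pi fun _ => measurableSet_posDef p
  have hrestrict : (Measure.pi fun _ : Fin k => hermLebesgue p).restrict
      {X | ∀ j, (X j).PosDef} = Measure.pi fun _ => (hermLebesgue p).restrict {X | X.PosDef} := by
    rw [hset, Measure.restrict_pi_pi]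
  have hint := integrable_dirichletKernel hα
  rw [eq_div_iff (cGammaP_ne_zero hσ), ← integral_mul_const,
    ← setIntegral_congr_fun hmeas fun X hX => integral_dirichletKernel_right hσ hX, hrestrict,
    ← integral_prod _ hint, integral_prod_symm _ hint,
    setIntegral_congr_fun (measurableSet_posDef p) fun Y hY => integral_dirichletKernel_left hα hY,
    integral_const_mul, (integral_gammaKernel p (hα (Fin.last k)) PosDef.one).2,
    Fin.prod_univ_castSucc]
  simp
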